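/- Let n ≥ 3 be an odd integer with n ≡ 0 (mod 3). (1) If g' ≥ (n−3)(n−1)/2, g' ≥ 1 and g' ≠ (n²−2n−1)/2, then there exists a primary data set of type B of degree n and genus 2g'. (2) If g' = (n−3)(n−1)/2 − 1, or g' = (n²−2n−1)/2, or 0 < g' < n−1, then there is no primary data set of type B of degree n and genus 2g'. -/

import Mathlib

/-- A data set of type B (degree `n`), as in Parlak–Stukow:
conditions (D1), (D2), (D3B), (D4B). -/
structure DataSetB where
  n : ℤ
  g0 : ℤ
  a : ℤ
  b : ℤ
  m : ℕ
  c : Fin m → ℤ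
  ni : Fin m → ℤ
  /-- (D1): `n > 1` is odd -/
  n_gt_one : 1 < n
  n_odd : Odd n
  /-- (D1): each `nᵢ > 1` -/
  ni_gt_one : ∀ i, 1 < ni i
  /-- (D1): each `nᵢ` divides `n` -/
  ni_dvd : ∀ i, ni i ∣ n
  /-- (D2) -/
  gcd_a : Int.gcd a n = 1
  gcd_b : Int.gcd b n = 1
  gcd_c : ∀ i, Int.gcd (c i) (ni i) = 1
  /-- (D3B): `g₀ ≥ 0` -/
  g0_nonneg : 0 ≤ g0
  /-- (D3B): `b − a = ab mod n` -/
  D3B : b - a ≡ a * b [ZMOD n]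
  /-- (D4B): `a + b + Σᵢ (n/nᵢ)·cᵢ = 0 mod n` -/
  D4B : a + b + ∑ i, (n / ni i) * c i ≡ 0 [ZMOD n]

/-- The genus of a type B data set: `g = 2g₀·n + Σᵢ (n/nᵢ)(nᵢ − 1)`. -/
def DataSetB.genus (D : DataSetB) : ℤ :=
  2 * D.g0 * D.n + ∑ i, (D.n / D.ni i) * (D.ni i - 1)

/-- A family of `m ≠ 1` units modulo an odd number can be chosen with sum zero. -/
theorem exists_coprime_family_sum_eq_zero {n : ℤ} (hodd : Odd n) :
    ∀ m : ℕ, m ≠ 1 → ∃ c : Fin m → ℤ, (∀ i, Int.gcd (c i) n = 1) ∧ ∑ i, c i = 0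
  | 0, _ => ⟨fun _ => 1, by simp, by simp⟩
  | 1, h => absurd rfl h
  | 3, _ => by
    have h2 : Int.gcd 2 n = 1 := Int.isCoprime_iff_gcd_eq_one.1 (Int.isCoprime_two_left.2 hodd)
    refine ⟨![1, 1, -2], fun i => ?_, by simp [Fin.sum_univ_three]⟩
    fin_cases i <;> simp [h2]
  | 2, _ => ⟨![1, -1], fun i => by fin_cases i <;> simp, by simp⟩
  | m + 4, _ => by
    obtain ⟨c, hc, hsum⟩ := exists_coprime_family_sum_eq_zero hodd (m + 2) (by omega)
    refine ⟨Fin.cons 1 (Fin.cons (-1) c), ?_, by simp [Fin.sum_univ_succ (n := m + 3),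
      Fin.sum_univ_succ (n := m + 2), hsum]⟩
    simp [Fin.forall_fin_succ (n := m + 3), Fin.forall_fin_succ (n := m + 2), hc]

theorem DataSetB.genus_of_primary (D : DataSetB) (hD : ∀ i, D.ni i = D.n) :
    D.genus = 2 * D.g0 * D.n + D.m * (D.n - 1) := by
  have hn : D.n ≠ 0 := by linarith [D.n_gt_one]
  simp [DataSetB.genus, hD, Int.ediv_self hn, mul_sub_one]

/-- Modulo `3`, conditions (D2) and (D3B) force `a + b ≡ 0`. -/
theorem DataSetB.three_dvd_a_add_b (D : DataSetB) (h3 : 3 ∣ D.n) : 3 ∣ D.a + D.b := by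
  have not_dvd {x : ℤ} (hx : Int.gcd x D.n = 1) : ¬ 3 ∣ x := fun h => by
    have := Int.dvd_coe_gcd h h3
    rw [hx] at this
    omega
  have ha := not_dvd D.gcd_a
  have hb := not_dvd D.gcd_b
  have h : D.b - D.a ≡ D.a * D.b [ZMOD 3] := D.D3B.of_dvd h3
  have ha' : D.a % 3 = 1 ∨ D.a % 3 = 2 := by omega
  have hb' : D.b % 3 = 1 ∨ D.b % 3 = 2 := by omega
  rw [Int.ModEq, Int.mul_emod] at h
  rcases ha' with ha' | ha' <;> rcases hb' with hb' | hb' <;> rw [ha', hb'] at h <;> omega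

theorem DataSetB.m_ne_one_of_primary (D : DataSetB) (hD : ∀ i, D.ni i = D.n) (h3 : 3 ∣ D.n) :
    D.m ≠ 1 := by
  intro hm
  have hab := D.three_dvd_a_add_b h3
  have hn : D.n ≠ 0 := by linarith [D.n_gt_one]
  have hsum := (D.D4B.of_dvd h3).dvd
  have hgcd := D.gcd_c
  obtain ⟨n, g0, a, b, m, c, ni⟩ := D
  dsimp only at *
  subst hm
  simp only [hD, Int.ediv_self hn, Fin.sum_univ_one, one_mul] at hsum hgcd
  have hc : 3 ∣ c 0 := by omega
  have := Int.dvd_coe_gcd hc h3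
  rw [hgcd 0] at this
  omega

/-- When `3 ∣ n`, primary type B data sets exist exactly with a number of cone points other
than `1`. -/
theorem exists_primary_dataSetB_iff {n : ℤ} (hn : 3 ≤ n) (hodd : Odd n) (h3 : 3 ∣ n) (g : ℤ) :
    (∃ D : DataSetB, (∀ i, D.ni i = D.n) ∧ D.n = n ∧ D.genus = g) ↔
      ∃ (g0 : ℤ) (m : ℕ), 0 ≤ g0 ∧ m ≠ 1 ∧ g = 2 * g0 * n + m * (n - 1) := by
  constructor
  · rintro ⟨D, hD, rfl, rfl⟩
    exact ⟨D.g0, D.m, D.g0_nonneg, D.m_ne_one_of_primary hD h3, D.genus_of_primary hD⟩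
  · rintro ⟨g0, m, hg0, hm, rfl⟩
    obtain ⟨c, hc, hsum⟩ := exists_coprime_family_sum_eq_zero hodd m hm
    have h2 : Int.gcd 2 n = 1 := Int.isCoprime_iff_gcd_eq_one.1 (Int.isCoprime_two_left.2 hodd)
    have hn0 : n ≠ 0 := by omega
    let D : DataSetB :=
      { n := n, g0 := g0, a := 2, b := -2, m := m, c := c, ni := fun _ => n
        n_gt_one := by omega
        n_odd := hodd
        ni_gt_one := fun _ => by omega
        ni_dvd := fun _ => dvd_rfl
        gcd_a := h2
        gcd_b := by rw [Int.neg_gcd, h2]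
        gcd_c := hc
        g0_nonneg := hg0
        D3B := by norm_num [Int.ModEq.refl]
        D4B := by simp [Int.ediv_self hn0, hsum, Int.ModEq.refl] }
    exact ⟨D, fun _ => rfl, rfl, D.genus_of_primary fun _ => rfl⟩

/-- The numbers `2k(k - 1)` and above, except `2k² - 1`, have the form `g₀(2k + 1) + mk` with
`m ≠ 1`. -/
theorem exists_representation_ne_one {k g : ℤ} (hk : 1 ≤ k) (hg : 2 * k * (k - 1) ≤ g)
    (hne : g ≠ 2 * k ^ 2 - 1) :
    ∃ (g0 : ℤ) (m : ℕ), 0 ≤ g0 ∧ m ≠ 1 ∧ g = g0 * (2 * k + 1) + m * k := by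
  obtain ⟨m, hm⟩ := Int.eq_ofNat_of_zero_le (Int.emod_nonneg (-2 * g) (by omega : 2 * k + 1 ≠ 0))
  have hlt := Int.emod_lt_of_pos (-2 * g) (by omega : 0 < 2 * k + 1)
  have hdiv := Int.emod_add_mul_ediv (-2 * g) (2 * k + 1)
  set q := (-2 * g) / (2 * k + 1)
  rw [hm] at hlt hdiv
  have hrep : g = (g + k * q) * (2 * k + 1) + m * k := by linear_combination (-k) * hdiv
  have hpos : 0 ≤ g + k * q := by
    by_contra! h
    nlinarith
  by_cases hm1 : m = 1
  · subst hm1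
    have hle : k ≤ g + k * q := by
      by_contra! h
      rcases (by omega : g + k * q = k - 1 ∨ g + k * q ≤ k - 2) with h | h
      · rw [h] at hrep
        apply hne
        rw [hrep]
        push_cast
        ring
      · push_cast at hrep
        nlinarith
    refine ⟨g + k * q - k, (2 * k + 2).toNat, by omega, by omega, ?_⟩
    rw [Int.toNat_of_nonneg (by omega)]
    push_cast at hrep
    linear_combination hrep
  · exact ⟨g + k * q, m, hpos, hm1, hrep⟩

theorem not_representation_ne_one {k g : ℤ} (hk : 1 ≤ k)
    (hg : g = 2 * k * (k - 1) - 1 ∨ g = 2 * k ^ 2 - 1 ∨ (0 < g ∧ g < 2 * k)) :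
    ¬ ∃ (g0 : ℤ) (m : ℕ), 0 ≤ g0 ∧ m ≠ 1 ∧ g = g0 * (2 * k + 1) + m * k := by
  rintro ⟨g0, m, hg0, hm, h⟩
  obtain ⟨m', hm'⟩ : ∃ m' : ℤ, m' = m := ⟨_, rfl⟩
  have hm0 : 0 ≤ m' := by omega
  have hm1 : m' ≠ 1 := by omega
  rw [← hm'] at h
  rcases hg with rfl | rfl | ⟨hpos, hlt⟩
  · obtain ⟨t, ht⟩ : k ∣ g0 + 1 := ⟨2 * k - 2 - m' - 2 * g0, by linear_combination -h⟩
    have ht1 : 1 ≤ t := by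
      by_contra! ht0
      nlinarith
    nlinarith [mul_le_mul_of_nonneg_left ht1 (by omega : 0 ≤ k)]
  · obtain ⟨t, ht⟩ : k ∣ g0 + 1 := ⟨2 * k - m' - 2 * g0, by linear_combination -h⟩
    have ht1 : 1 ≤ t := by
      by_contra! ht0
      nlinarith
    have hm'' : m' = 2 * k + 2 - t * (2 * k + 1) := by
      apply mul_left_cancel₀ (by omega : k ≠ 0)
      linear_combination -h - (2 * k + 1) * ht
    rcases (by omega : t = 1 ∨ 2 ≤ t) with rfl | ht2
    · omega
    · nlinarith
  · rcases (by omega : g0 = 0 ∨ 1 ≤ g0) with rfl | h1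
    · rcases (by omega : m' = 0 ∨ 2 ≤ m') with rfl | h2
      · omega
      · nlinarith
    · nlinarith

/-- Theorem 5.2(2): for odd `n ≥ 3` with `n ≡ 0 (mod 3)`, a primary
(all `nᵢ = n`) type B data set of degree `n` and genus `2g'` exists if
`g' ≥ (n−3)(n−1)/2`, `g' ≥ 1` and `g' ≠ (n²−2n−1)/2`, and does not exist if
`g' = (n−3)(n−1)/2 − 1`, `g' = (n²−2n−1)/2`, or `0 < g' < n−1`. -/
theorem primary_typeB_n_div_three (n : ℤ) (hn : 3 ≤ n) (hodd : Odd n)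
    (h3 : (3 : ℤ) ∣ n) (g' : ℤ) :
    ((1 ≤ g' ∧ (n - 3) * (n - 1) / 2 ≤ g' ∧ g' ≠ (n ^ 2 - 2 * n - 1) / 2) →
      ∃ D : DataSetB, (∀ i, D.ni i = D.n) ∧ D.n = n ∧ D.genus = 2 * g') ∧
    ((g' = (n - 3) * (n - 1) / 2 - 1 ∨ g' = (n ^ 2 - 2 * n - 1) / 2 ∨
        (0 < g' ∧ g' < n - 1)) →
      ¬ ∃ D : DataSetB, (∀ i, D.ni i = D.n) ∧ D.n = n ∧ D.genus = 2 * g') := by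
  obtain ⟨k, hk⟩ := id hodd
  have hk1 : 1 ≤ k := by omega
  have hfrob : (n - 3) * (n - 1) / 2 = 2 * k * (k - 1) := by
    rw [hk, Int.ediv_eq_of_eq_mul_right two_ne_zero]
    ring
  have hexc : (n ^ 2 - 2 * n - 1) / 2 = 2 * k ^ 2 - 1 := by
    rw [hk, Int.ediv_eq_of_eq_mul_right two_ne_zero]
    ring
  have hiff : (∃ D : DataSetB, (∀ i, D.ni i = D.n) ∧ D.n = n ∧ D.genus = 2 * g') ↔
      ∃ (g0 : ℤ) (m : ℕ), 0 ≤ g0 ∧ m ≠ 1 ∧ g' = g0 * (2 * k + 1) + m * k := by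
    rw [exists_primary_dataSetB_iff hn hodd h3]
    refine exists_congr fun g0 => exists_congr fun m => and_congr_right fun _ =>
      and_congr_right fun _ => ?_
    rw [hk, show 2 * g0 * (2 * k + 1) + m * (2 * k + 1 - 1) =
      2 * (g0 * (2 * k + 1) + m * k) by ring]
    exact mul_right_inj' two_ne_zero
  rw [hiff, hfrob, hexc]
  exact ⟨fun ⟨_, hg, hne⟩ => exists_representation_ne_one hk1 hg hne,
    fun hg => not_representation_ne_one hk1 (hg.imp_right (Or.imp_right fun h => ⟨h.1, by omega⟩))⟩
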